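/- Suppose p > p_S. For each γ > 0 the initial value problem ū''(ρ) + ((N−1)/ρ)ū'(ρ) + ū(ρ)^p = 0 for ρ > 0, ū(0) = γ, ū'(0) = 0, has a unique solution ū(·,γ) ∈ C²([0,∞)), this solution is positive on [0,∞), and it satisfies the scaling relation ū(ρ,γ) = γ ū(γ^{(p−1)/2} ρ, 1) for all ρ ≥ 0. Moreover, if in addition p < p_JL, then for every γ > 0 the set { ρ > 0 : ū(ρ,γ) = A ρ^{−θ} } is infinite. -/

import Mathlib

open Real Set Filter Topology MeasureTheory

noncomputable section

/-- The nonlinearity `f(u) = -u + u^p`. -/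
def fNL (p u : ℝ) : ℝ := -u + u ^ p

/-- The Sobolev critical exponent `p_S = (N+2)/(N-2)`. -/
def pSob (N : ℕ) : ℝ := ((N : ℝ) + 2) / ((N : ℝ) - 2)

/-- `θ = 2/(p-1)`. -/
def thetaP (p : ℝ) : ℝ := 2 / (p - 1)

/-- `A = (θ(N-2-θ))^{1/(p-1)}`. -/
def Aconst (N : ℕ) (p : ℝ) : ℝ :=
  (thetaP p * ((N : ℝ) - 2 - thetaP p)) ^ (1 / (p - 1))

/-- `m = (θ(N-2-θ))^{-1/2}`. -/
def mConst (N : ℕ) (p : ℝ) : ℝ :=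
  (thetaP p * ((N : ℝ) - 2 - thetaP p)) ^ (-(1 / 2) : ℝ)

/-- `α = m(N-2-2θ)`. -/
def alphaConst (N : ℕ) (p : ℝ) : ℝ :=
  mConst N p * ((N : ℝ) - 2 - 2 * thetaP p)

/-- The condition `p < p_JL`, where `p_JL = 1 + 4/(N-4-2√(N-1))` for `N ≥ 11` and
`p_JL = ∞` for `N ≤ 10`. -/
def pJLcond (N : ℕ) (p : ℝ) : Prop :=
  11 ≤ N → p < 1 + 4 / ((N : ℝ) - 4 - 2 * Real.sqrt ((N : ℝ) - 1))

/-- `y` is a C² solution of `y'' + α y' - y + y^p - m² e^{2mt} y = 0` on `(-∞, T]`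
with `y → 1` as `t → -∞`; `y'`, `y''` are its first and second derivatives. -/
def IsSingODEOn (N : ℕ) (p T : ℝ) (y y' y'' : ℝ → ℝ) : Prop :=
  (∀ t ∈ Iic T, HasDerivWithinAt y (y' t) (Iic T) t) ∧
  (∀ t ∈ Iic T, HasDerivWithinAt y' (y'' t) (Iic T) t) ∧
  ContinuousOn y'' (Iic T) ∧
  (∀ t ∈ Iic T, y'' t + alphaConst N p * y' t - y t + y t ^ p
      - (mConst N p) ^ 2 * Real.exp (2 * mConst N p * t) * y t = 0) ∧
  Tendsto y atBot (𝓝 1)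

/-- `y` is a C² solution of `y'' + α y' - y + y^p - m² e^{2mt} y = 0` on all of `ℝ`
with `y → 1` as `t → -∞`. -/
def IsEntireSingODE (N : ℕ) (p : ℝ) (y y' y'' : ℝ → ℝ) : Prop :=
  (∀ t : ℝ, HasDerivAt y (y' t) t) ∧
  (∀ t : ℝ, HasDerivAt y' (y'' t) t) ∧
  Continuous y'' ∧
  (∀ t : ℝ, y'' t + alphaConst N p * y' t - y t + y t ^ p
      - (mConst N p) ^ 2 * Real.exp (2 * mConst N p * t) * y t = 0) ∧
  Tendsto y atBot (𝓝 1)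

/-- The singular solution `u*(s) = A s^{-θ} y*(m⁻¹ log s)` built from `y*`. -/
def ustar (N : ℕ) (p : ℝ) (y : ℝ → ℝ) (s : ℝ) : ℝ :=
  Aconst N p * s ^ (-(thetaP p)) * y (Real.log s / mConst N p)

/-- `u` is a C² solution on `[0,∞)` of the IVP `u'' + ((N-1)/s)u' + f(u) = 0`,
`u(0) = γ`, `u'(0) = 0`, with nonlinearity `f(u) = -u + u^p`. -/
def IsIVPSol (N : ℕ) (p γ : ℝ) (u u' u'' : ℝ → ℝ) : Prop :=
  (∀ s ∈ Ici (0:ℝ), HasDerivWithinAt u (u' s) (Ici 0) s) ∧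
  (∀ s ∈ Ici (0:ℝ), HasDerivWithinAt u' (u'' s) (Ici 0) s) ∧
  ContinuousOn u'' (Ici 0) ∧
  u 0 = γ ∧ u' 0 = 0 ∧
  (∀ s > (0:ℝ), u'' s + ((N : ℝ) - 1) / s * u' s + fNL p (u s) = 0)

/-- `u` is a C² solution on `[0,∞)` of the IVP `u'' + ((N-1)/ρ)u' + u^p = 0`,
`u(0) = γ`, `u'(0) = 0`. -/
def IsBarSol (N : ℕ) (p γ : ℝ) (u u' u'' : ℝ → ℝ) : Prop :=
  (∀ ρ ∈ Ici (0:ℝ), HasDerivWithinAt u (u' ρ) (Ici 0) ρ) ∧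
  (∀ ρ ∈ Ici (0:ℝ), HasDerivWithinAt u' (u'' ρ) (Ici 0) ρ) ∧
  ContinuousOn u'' (Ici 0) ∧
  u 0 = γ ∧ u' 0 = 0 ∧
  (∀ ρ > (0:ℝ), u'' ρ + ((N : ℝ) - 1) / ρ * u' ρ + u ρ ^ p = 0)

/-- `s` is the `(k+1)`-th positive critical point of a function whose derivative is `u'`:
`s` is a positive critical point having exactly `k` positive critical points below it. -/
def IsNthCritPt (u' : ℝ → ℝ) (k : ℕ) (s : ℝ) : Prop :=
  0 < s ∧ u' s = 0 ∧ {x : ℝ | 0 < x ∧ x < s ∧ u' x = 0}.encard = (k : ℕ∞)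

/-- `U` is a positive C² radial solution of the Neumann problem
`U'' + ((N-1)/r)U' + λ f(U) = 0` on `(0,1)`, `U'(0) = U'(1) = 0`, `U > 0` on `[0,1]`. -/
def NeumannSol (N : ℕ) (p lam : ℝ) (U U' U'' : ℝ → ℝ) : Prop :=
  (∀ r ∈ Icc (0:ℝ) 1, HasDerivWithinAt U (U' r) (Icc 0 1) r) ∧
  (∀ r ∈ Icc (0:ℝ) 1, HasDerivWithinAt U' (U'' r) (Icc 0 1) r) ∧
  ContinuousOn U'' (Icc 0 1) ∧
  (∀ r ∈ Ioo (0:ℝ) 1, U'' r + ((N : ℝ) - 1) / r * U' r + lam * fNL p (U r) = 0) ∧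
  U' 0 = 0 ∧ U' 1 = 0 ∧ (∀ r ∈ Icc (0:ℝ) 1, 0 < U r)

/-- `(lam, U)` is a singular solution of the Neumann problem whose graph meets `1`
exactly `n` times: `U` is C² on `(0,1)`, continuous on `(0,1]`, `U'(1) = 0`, it solves
`U'' + ((N-1)/r)U' + λ f(U) = 0` on `(0,1)`, satisfies the asymptotics
`U(r) = A(√λ r)^{-θ}(1+o(1))` as `r ↓ 0` (i.e. `r^θ U(r) → A λ^{-θ/2}`),
`U - 1` has exactly `n` zeros in `(0,1]`, and `U > 0` on `(0,1]`. -/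
def SingBVPSol (N : ℕ) (p lam : ℝ) (n : ℕ) (U U' U'' : ℝ → ℝ) : Prop :=
  (∀ r ∈ Ioc (0:ℝ) 1, HasDerivWithinAt U (U' r) (Ioc 0 1) r) ∧
  (∀ r ∈ Ioo (0:ℝ) 1, HasDerivAt U' (U'' r) r) ∧
  ContinuousOn U (Ioc 0 1) ∧
  ContinuousOn U'' (Ioo 0 1) ∧
  (∀ r ∈ Ioo (0:ℝ) 1, U'' r + ((N : ℝ) - 1) / r * U' r + lam * fNL p (U r) = 0) ∧
  U' 1 = 0 ∧
  Tendsto (fun r => r ^ thetaP p * U r) (𝓝[>] (0:ℝ))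
    (𝓝 (Aconst N p * lam ^ (-(thetaP p) / 2))) ∧
  {r ∈ Ioc (0:ℝ) 1 | U r = 1}.encard = (n : ℕ∞) ∧
  (∀ r ∈ Ioc (0:ℝ) 1, 0 < U r)

/-- A positive function cannot satisfy an oscillatory second order differential inequality on a
half-line. -/
theorem no_positive_oscillatory_supersolution {a c T : ℝ} (hac : a ^ 2 < 4 * c) {y y' y'' : ℝ → ℝ}
    (hy : ∀ t ≥ T, HasDerivAt y (y' t) t) (hy' : ∀ t ≥ T, HasDerivAt y' (y'' t) t)
    (hpos : ∀ t ≥ T, 0 < y t) (hineq : ∀ t ≥ T, y'' t + a * y' t + c * y t ≤ 0) : False := by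
  set δ := √(c - a ^ 2 / 4) with hδ
  have hδ0 : 0 < δ := Real.sqrt_pos.2 (by linarith)
  have hδ2 : δ ^ 2 = c - a ^ 2 / 4 := Real.sq_sqrt (by linarith)
  let φ : ℝ → ℝ := fun t => arctan ((y' t / y t + a / 2) / δ) + δ * t
  have hφ : ∀ t ≥ T, ∃ d ≤ 0, HasDerivAt φ d t := by
    intro t ht
    have h0 := (hpos t ht).ne'
    have h1 := (((((hy' t ht).div (hy t ht) h0).add_const (a / 2)).div_const δ).arctan).add
      ((hasDerivAt_id t).const_mul δ)
    refine ⟨_, ?_, h1⟩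
    set Y := y t with hY
    have hYp : 0 < Y := hpos t ht
    have h2 := hineq t ht
    simp only [Pi.div_apply]
    rw [← hY] at h2 ⊢
    have e1 : 1 / (1 + ((y' t / Y + a / 2) / δ) ^ 2) * ((y'' t * Y - y' t * y' t) / Y ^ 2 / δ)
        = δ * ((y'' t * Y - y' t * y' t) / (δ ^ 2 * Y ^ 2 + (y' t + a / 2 * Y) ^ 2)) := by
      have : 0 < δ ^ 2 * Y ^ 2 + (y' t + a / 2 * Y) ^ 2 := by positivity
      have : 0 < 1 + ((y' t / Y + a / 2) / δ) ^ 2 := by positivity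
      field_simp
    rw [e1]
    have hD : 0 < δ ^ 2 * Y ^ 2 + (y' t + a / 2 * Y) ^ 2 := by positivity
    have h3 : (y'' t * Y - y' t * y' t) / (δ ^ 2 * Y ^ 2 + (y' t + a / 2 * Y) ^ 2) ≤ -1 := by
      rw [div_le_iff₀ hD, hδ2]
      nlinarith [mul_le_mul_of_nonneg_right h2 hYp.le]
    nlinarith
  have hanti : AntitoneOn φ (Ici T) := by
    apply antitoneOn_of_deriv_nonpos (convex_Ici T)
    · intro t ht
      obtain ⟨d, _, h⟩ := hφ t ht
      exact h.continuousAt.continuousWithinAt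
    · intro t ht
      obtain ⟨d, _, h⟩ := hφ t (interior_subset ht)
      exact h.differentiableAt.differentiableWithinAt
    · intro t ht
      obtain ⟨d, hd, h⟩ := hφ t (interior_subset ht)
      rwa [h.deriv]
  have hle : T ≤ T + π / δ := by
    have : 0 < π / δ := by positivity
    linarith
  have h := hanti (mem_Ici.2 le_rfl) (mem_Ici.2 hle) hle
  simp only [φ] at h
  have e : δ * (T + π / δ) = δ * T + π := by field_simp
  rw [e] at h
  have h1 := arctan_lt_pi_div_two ((y' T / y T + a / 2) / δ)
  have h2 := neg_pi_div_two_lt_arctan ((y' (T + π / δ) / y (T + π / δ) + a / 2) / δ)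
  linarith

/-- A function with a derivative bounded below by `ε` grows at least linearly. -/
theorem add_mul_le_of_hasDerivAt_ge {ε T : ℝ} {q q' : ℝ → ℝ}
    (hq : ∀ t ≥ T, HasDerivAt q (q' t) t) (hε : ∀ t ≥ T, ε ≤ q' t) :
    ∀ t ≥ T, q T + ε * (t - T) ≤ q t := by
  intro t ht
  have hmono : MonotoneOn (fun t => q t - ε * t) (Ici T) := by
    have hd : ∀ t ≥ T, HasDerivAt (fun t => q t - ε * t) (q' t - ε * 1) t := fun t ht =>
      (hq t ht).sub ((hasDerivAt_id t).const_mul ε)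
    apply monotoneOn_of_deriv_nonneg (convex_Ici T)
    · exact fun t ht => (hd t ht).continuousAt.continuousWithinAt
    · exact fun t ht => (hd t (interior_subset ht)).differentiableAt.differentiableWithinAt
    · intro t ht
      rw [(hd t (interior_subset ht)).deriv]
      linarith [hε t (interior_subset ht)]
  have := hmono (mem_Ici.2 le_rfl) (mem_Ici.2 ht) ht
  linarith

/-- A bounded solution of `w'' + a w' = r` cannot have a forcing term `r` bounded below by a
positive constant. -/
theorem not_forcing_ge_of_bounded {a ε B T : ℝ} (ha : 0 < a) (hε : 0 < ε) {w w' w'' : ℝ → ℝ}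
    (hw : ∀ t ≥ T, HasDerivAt w (w' t) t) (hw' : ∀ t ≥ T, HasDerivAt w' (w'' t) t)
    (hB : ∀ t ≥ T, w t ≤ B) (hge : ∀ t ≥ T, ε ≤ w'' t + a * w' t) : False := by
  have hq := add_mul_le_of_hasDerivAt_ge (q := fun t => w' t + a * w t)
    (fun t ht => (hw' t ht).add ((hw t ht).const_mul a)) hge
  set S := max T (T + (a * B + 1 - (w' T + a * w T)) / ε) with hS
  have hTS : T ≤ S := le_max_left _ _
  have h1 : ∀ t ≥ S, 1 ≤ w' t := by
    intro t ht
    have h2 := hq t (hTS.trans ht)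
    have h3 : (a * B + 1 - (w' T + a * w T)) / ε ≤ t - T := by
      linarith [le_max_right T (T + (a * B + 1 - (w' T + a * w T)) / ε)]
    rw [div_le_iff₀ hε] at h3
    have h4 := mul_le_mul_of_nonneg_left (hB t (hTS.trans ht)) ha.le
    linarith
  have h5 := add_mul_le_of_hasDerivAt_ge (fun t ht => hw t (hTS.trans ht)) h1
  have h6 : S ≤ S + (|B - w S| + 1) := by linarith [abs_nonneg (B - w S)]
  have h7 := h5 _ h6
  have h8 := hB _ (hTS.trans h6)
  linarith [le_abs_self (B - w S)]

/-- The nonlinearity `x ^ p - A ^ (p - 1) * x` lies above its tangent line at `A`. -/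
theorem rpow_sub_mul_ge_tangent {p A x : ℝ} (hp : 1 < p) (hA : 0 < A) (hx : 0 < x) :
    (p - 1) * A ^ (p - 1) * (x - A) ≤ x ^ p - A ^ (p - 1) * x := by
  have h := one_add_mul_self_le_rpow_one_add (s := x / A - 1) (by
    have : 0 < x / A := by positivity
    linarith) hp.le
  have e1 : (1 + (x / A - 1)) ^ p = x ^ p / A ^ p := by
    rw [add_sub_cancel, div_rpow hx.le hA.le]
  have e2 : A ^ p = A ^ (p - 1) * A := by
    rw [← rpow_add_one hA.ne']; ring_nf
  have hAp : 0 < A ^ (p - 1) := by positivity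
  rw [e1, e2, le_div_iff₀ (by positivity)] at h
  have e3 : (1 + p * (x / A - 1)) * (A ^ (p - 1) * A) = A ^ (p - 1) * (A + p * (x - A)) := by
    field_simp
  rw [e3] at h
  nlinarith

theorem rpow_sub_mul_neg {p A x : ℝ} (hp : 1 < p) (hx : 0 < x) (hxA : x < A) :
    x ^ p - A ^ (p - 1) * x < 0 := by
  have e2 : x ^ p = x ^ (p - 1) * x := by
    rw [← rpow_add_one hx.ne']; ring_nf
  have h := rpow_lt_rpow hx.le hxA (by linarith : 0 < p - 1)
  rw [e2]
  nlinarith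

/-- Just below `A`, the nonlinearity `x ^ p - A ^ (p - 1) * x` lies below any line through `(A, 0)`
with slope smaller than its derivative there. -/
theorem exists_rpow_sub_mul_le_chord {p A c : ℝ} (hA : 0 < A)
    (hc : c < (p - 1) * A ^ (p - 1)) :
    ∃ η > 0, ∀ x, A - η < x → x < A → x ^ p - A ^ (p - 1) * x ≤ c * (x - A) := by
  have hd : HasDerivAt (fun x : ℝ => x ^ p - A ^ (p - 1) * x)
      (p * A ^ (p - 1) - A ^ (p - 1) * 1) A :=
    (hasDerivAt_rpow_const (Or.inl hA.ne')).sub ((hasDerivAt_id A).const_mul _)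
  have h1 := hd.tendsto_slope
  have h2 := h1.eventually (lt_mem_nhds (show c < p * A ^ (p - 1) - A ^ (p - 1) * 1 by linarith))
  rw [eventually_nhdsWithin_iff, Metric.eventually_nhds_iff] at h2
  obtain ⟨ε, hε, h2⟩ := h2
  refine ⟨ε, hε, fun x hx1 hx2 => ?_⟩
  have h3 := @h2 x (by
    rw [Real.dist_eq, abs_lt]; constructor <;> linarith) hx2.ne
  have e2 : A ^ p = A ^ (p - 1) * A := by
    rw [← rpow_add_one hA.ne']; ring_nf
  rw [slope_def_field, lt_div_iff_of_neg (by linarith)] at h3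
  simp only [e2, sub_self, sub_zero] at h3
  exact h3.le

/-- Solutions of the autonomous Emden-Fowler equation that stay away from zero return to the
equilibrium `A` arbitrarily late when the linearization at `A` is oscillatory. -/
theorem exists_ge_eq_equilibrium {a p A κ : ℝ} (ha : 0 < a) (hp : 1 < p) (hA : 0 < A) (hκ : 0 < κ)
    (hosc : a ^ 2 < 4 * ((p - 1) * A ^ (p - 1))) {w w' : ℝ → ℝ}
    (hw : ∀ t, HasDerivAt w (w' t) t)
    (hw' : ∀ t, HasDerivAt w' (-a * w' t + A ^ (p - 1) * w t - w t ^ p) t)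
    {T : ℝ} (hκw : ∀ t ≥ T, κ ≤ w t) : ∃ t ≥ T, w t = A := by
  by_contra! hne
  have hwc : Continuous w := continuous_iff_continuousAt.2 fun t => (hw t).continuousAt
  have hpos : ∀ t ≥ T, 0 < w t := fun t ht => hκ.trans_le (hκw t ht)
  rcases lt_or_gt_of_ne (hne T le_rfl) with hT | hT
  · have hlt : ∀ t ≥ T, w t < A := by
      intro t ht
      by_contra! h
      obtain ⟨s, hs, hs'⟩ := intermediate_value_Icc ht hwc.continuousOn ⟨hT.le, h⟩
      exact hne s hs.1 hs'
    -- the solution cannot stay below a level under `A`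
    have hlevel : ∀ B < A, ∀ S ≥ T, ∃ t ≥ S, B < w t := by
      intro B hB S hS
      by_contra! h
      have hκB : κ ≤ B := (hκw S hS).trans (h S le_rfl)
      obtain ⟨x, hx, hmax⟩ := isCompact_Icc.exists_isMaxOn (nonempty_Icc.2 hκB)
        (f := fun x : ℝ => x ^ p - A ^ (p - 1) * x)
        ((continuous_id.rpow_const fun _ => Or.inr (by linarith)).sub
          (continuous_const.mul continuous_id)).continuousOn
      have hneg := rpow_sub_mul_neg hp (hκ.trans_le hx.1) (hx.2.trans_lt hB)
      refine not_forcing_ge_of_bounded ha (neg_pos.2 hneg) (fun t _ => hw t) (fun t _ => hw' t) h ?_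
      intro t ht
      have : w t ^ p - A ^ (p - 1) * w t ≤ x ^ p - A ^ (p - 1) * x :=
        hmax (a := w t) ⟨hκw t (hS.trans ht), h t ht⟩
      linarith
    obtain ⟨T₁, hT₁, hw₁⟩ : ∃ t ≥ T, 0 < w' t := by
      by_contra! h
      have hanti : AntitoneOn w (Ici T) := by
        apply antitoneOn_of_deriv_nonpos (convex_Ici T) hwc.continuousOn
        · exact fun t _ => (hw t).differentiableAt.differentiableWithinAt
        · intro t ht
          rw [(hw t).deriv]
          exact h t (interior_subset ht)
      obtain ⟨t, ht, h'⟩ := hlevel (w T) hT T le_rfl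
      exact absurd (hanti (mem_Ici.2 le_rfl) (mem_Ici.2 ht) ht) h'.not_ge
    have hw'pos : ∀ t ≥ T₁, 0 < w' t := by
      intro t ht
      have hmono : MonotoneOn (fun t => exp (a * t) * w' t) (Ici T₁) := by
        have hd : ∀ t, HasDerivAt (fun t => exp (a * t) * w' t)
            (exp (a * t) * (a * 1) * w' t
              + exp (a * t) * (-a * w' t + A ^ (p - 1) * w t - w t ^ p)) t := fun t =>
          ((hasDerivAt_id t).const_mul a).exp.mul (hw' t)
        apply monotoneOn_of_deriv_nonneg (convex_Ici T₁)
        · exact fun t _ => (hd t).continuousAt.continuousWithinAt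
        · exact fun t _ => (hd t).differentiableAt.differentiableWithinAt
        · intro t ht
          have ht : T ≤ t := hT₁.trans (interior_subset ht)
          rw [(hd t).deriv]
          have := rpow_sub_mul_neg hp (hpos t ht) (hlt t ht)
          nlinarith [exp_pos (a * t)]
      have h := hmono (mem_Ici.2 le_rfl) (mem_Ici.2 ht) ht
      have h1 : 0 < exp (a * T₁) * w' T₁ := by positivity
      exact pos_of_mul_pos_right (h1.trans_le h) (exp_pos _).le
    have hmono : MonotoneOn w (Ici T₁) := by
      apply monotoneOn_of_deriv_nonneg (convex_Ici T₁) hwc.continuousOn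
      · exact fun t _ => (hw t).differentiableAt.differentiableWithinAt
      · intro t ht
        rw [(hw t).deriv]
        exact (hw'pos t (interior_subset ht)).le
    obtain ⟨c, hc1, hc2⟩ := exists_between (show a ^ 2 / 4 < (p - 1) * A ^ (p - 1) by linarith)
    obtain ⟨η, hη, hchord⟩ := exists_rpow_sub_mul_le_chord hA hc2
    obtain ⟨T₂, hT₂, hw₂⟩ := hlevel (A - η) (by linarith) T₁ hT₁
    refine no_positive_oscillatory_supersolution (a := a) (c := c) (T := T₂) (by linarith)
      (y := fun t => A - w t) (fun t _ => (hw t).const_sub A) (fun t _ => (hw' t).neg) ?_ ?_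
    · intro t ht
      linarith [hlt t (hT₁.trans (hT₂.trans ht))]
    · intro t ht
      have h1 := hmono (mem_Ici.2 hT₂) (mem_Ici.2 (hT₂.trans ht)) ht
      have := hchord (w t) (by linarith) (hlt t (hT₁.trans (hT₂.trans ht)))
      linarith
  · have hgt : ∀ t ≥ T, A < w t := by
      intro t ht
      by_contra! h
      obtain ⟨s, hs, hs'⟩ := intermediate_value_Icc' ht hwc.continuousOn ⟨h, hT.le⟩
      exact hne s hs.1 hs'
    refine no_positive_oscillatory_supersolution hosc
      (y := fun t => w t - A) (fun t _ => (hw t).sub_const A) (fun t _ => hw' t)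
      (fun t ht => by linarith [hgt t ht]) fun t ht => ?_
    have := rpow_sub_mul_ge_tangent hp hA (hpos t ht)
    linarith

/-- The average `∫₀¹ x ^ n * h (x * s) dx`, equal to `s ^ (-n - 1) * ∫₀ˢ t ^ n * h t dt`
for `s ≠ 0`. -/
def radialAverage (n : ℕ) (h : ℝ → ℝ) (s : ℝ) : ℝ := ∫ x in (0 : ℝ)..1, x ^ n * h (x * s)

theorem continuous_radialAverage (n : ℕ) {h : ℝ → ℝ} (hh : Continuous h) :
    Continuous (radialAverage n h) :=
  intervalIntegral.continuous_parametric_intervalIntegral_of_continuous'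
    (f := fun s x => x ^ n * h (x * s)) (by fun_prop) 0 1

theorem abs_radialAverage_le (n : ℕ) {h : ℝ → ℝ} {s M : ℝ}
    (hM : ∀ x ∈ Icc (0 : ℝ) 1, |h (x * s)| ≤ M) : |radialAverage n h s| ≤ M := by
  have h1 := intervalIntegral.norm_integral_le_of_norm_le_const (a := (0 : ℝ)) (b := 1) (C := M)
    (f := fun x => x ^ n * h (x * s)) (by
      intro x hx
      rw [uIoc_of_le zero_le_one] at hx
      rw [norm_eq_abs, abs_mul, abs_of_nonneg (pow_nonneg hx.1.le n)]
      have h2 := hM x ⟨hx.1.le, hx.2⟩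
      have h3 := pow_le_one₀ (n := n) hx.1.le hx.2
      nlinarith [abs_nonneg (h (x * s)), pow_nonneg hx.1.le n])
  simpa [radialAverage] using h1

theorem radialAverage_sub (n : ℕ) {h₁ h₂ : ℝ → ℝ} (hh₁ : Continuous h₁) (hh₂ : Continuous h₂)
    (s : ℝ) : radialAverage n h₁ s - radialAverage n h₂ s
      = radialAverage n (fun t => h₁ t - h₂ t) s := by
  unfold radialAverage
  rw [← intervalIntegral.integral_sub]
  · simp only [mul_sub]
  · exact Continuous.intervalIntegrable (by fun_prop) _ _
  · exact Continuous.intervalIntegrable (by fun_prop) _ _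

theorem pow_mul_radialAverage (n : ℕ) (h : ℝ → ℝ) (s : ℝ) :
    s ^ (n + 1) * radialAverage n h s = ∫ t in (0 : ℝ)..s, t ^ n * h t := by
  have h1 := intervalIntegral.mul_integral_comp_mul_right (a := 0) (b := 1)
    (f := fun t => t ^ n * h t) s
  simp only [zero_mul, one_mul] at h1
  rw [← h1, radialAverage, pow_succ', mul_assoc, ← intervalIntegral.integral_const_mul]
  congr 2
  ext x
  ring

theorem hasDerivAt_mul_radialAverage (n : ℕ) {h : ℝ → ℝ} (hh : Continuous h) (s : ℝ) :
    HasDerivAt (fun s => s * radialAverage n h s) (h s - n * radialAverage n h s) s := by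
  rcases eq_or_ne s 0 with rfl | hs
  · have hI : radialAverage n h 0 = h 0 - n * radialAverage n h 0 := by
      have : radialAverage n h 0 = h 0 / (n + 1) := by
        simp [radialAverage, integral_pow]
        ring
      rw [this]
      have : (n : ℝ) + 1 ≠ 0 := by positivity
      field_simp
      ring
    rw [← hI, hasDerivAt_iff_tendsto_slope]
    refine ((continuous_radialAverage n hh).tendsto 0).mono_left nhdsWithin_le_nhds |>.congr' ?_
    filter_upwards [self_mem_nhdsWithin] with t ht
    have ht : t ≠ 0 := ht
    rw [slope_def_field]
    simp only [zero_mul, sub_zero]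
    field_simp
  · have hJ : HasDerivAt (fun s => ∫ t in (0 : ℝ)..s, t ^ n * h t) (s ^ n * h s) s :=
      (Continuous.integral_hasStrictDerivAt (f := fun t => t ^ n * h t) (by fun_prop)
        0 s).hasDerivAt
    have hd := hJ.div (hasDerivAt_pow n s) (pow_ne_zero n hs)
    have heq : (fun s => s * radialAverage n h s) =ᶠ[𝓝 s]
        fun s => (∫ t in (0 : ℝ)..s, t ^ n * h t) / s ^ n := by
      filter_upwards [isOpen_ne.mem_nhds hs] with t ht
      have ht : t ≠ 0 := ht
      rw [← pow_mul_radialAverage]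
      field_simp
      ring
    refine (hd.congr_of_eventuallyEq heq).congr_deriv ?_
    rw [← pow_mul_radialAverage]
    rcases n with _ | n
    · simp
    · simp only [Nat.add_sub_cancel]
      field_simp
      ring

/-- The integral operator whose fixed points solve the radial initial value problem. -/
def radialPicard (n : ℕ) (γ : ℝ) (h : ℝ → ℝ) (x : ℝ) : ℝ :=
  γ - ∫ s in (0 : ℝ)..x, s * radialAverage n h s

theorem hasDerivAt_radialPicard (n : ℕ) (γ : ℝ) {h : ℝ → ℝ} (hh : Continuous h) (x : ℝ) :
    HasDerivAt (radialPicard n γ h) (-(x * radialAverage n h x)) x := by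
  have hc := continuous_radialAverage n hh
  exact ((Continuous.integral_hasStrictDerivAt (f := fun s => s * radialAverage n h s)
    (by fun_prop) 0 x).hasDerivAt).const_sub γ

theorem abs_radialPicard_le (n : ℕ) (γ : ℝ) {h : ℝ → ℝ} {M : ℝ} (hM : ∀ t, |h t| ≤ M) {x : ℝ}
    (hx : 0 ≤ x) : |radialPicard n γ h x| ≤ |γ| + M * x ^ 2 := by
  have h1 := intervalIntegral.norm_integral_le_of_norm_le_const (a := 0) (b := x) (C := x * M)
    (f := fun s => s * radialAverage n h s) (by
      intro s hs
      rw [uIoc_of_le hx] at hs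
      rw [norm_eq_abs, abs_mul, abs_of_pos hs.1]
      exact mul_le_mul hs.2 (abs_radialAverage_le n fun x _ => hM _) (abs_nonneg _) hx)
  rw [sub_zero, abs_of_nonneg hx, norm_eq_abs] at h1
  have := abs_sub γ (∫ s in (0 : ℝ)..x, s * radialAverage n h s)
  unfold radialPicard
  nlinarith

theorem abs_radialPicard_sub_le (n : ℕ) (γ : ℝ) {h₁ h₂ : ℝ → ℝ} (hh₁ : Continuous h₁)
    (hh₂ : Continuous h₂) {C k : ℝ} (hk : 0 < k)
    (hC : ∀ t, |h₁ t - h₂ t| ≤ C * exp (k * t ^ 2)) {x : ℝ} (hx : 0 ≤ x) :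
    |radialPicard n γ h₁ x - radialPicard n γ h₂ x| ≤ C / (2 * k) * exp (k * x ^ 2) := by
  have hC0 : 0 ≤ C := by simpa using (abs_nonneg _).trans (hC 0)
  have hc₁ := continuous_radialAverage n hh₁
  have hc₂ := continuous_radialAverage n hh₂
  have e1 : radialPicard n γ h₂ x - radialPicard n γ h₁ x
      = ∫ s in (0 : ℝ)..x, s * radialAverage n (fun t => h₁ t - h₂ t) s := by
    simp only [radialPicard, sub_sub_sub_cancel_left]
    rw [← intervalIntegral.integral_sub]
    · simp only [← mul_sub, radialAverage_sub n hh₁ hh₂]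
    · exact Continuous.intervalIntegrable (by fun_prop) _ _
    · exact Continuous.intervalIntegrable (by fun_prop) _ _
  have hprim : ∀ s : ℝ, HasDerivAt (fun s => C / (2 * k) * exp (k * s ^ 2))
      (s * (C * exp (k * s ^ 2))) s := by
    intro s
    refine ((((hasDerivAt_pow 2 s).const_mul k).exp).const_mul (C / (2 * k))).congr_deriv ?_
    field_simp
    simp
  have e2 : ∫ s in (0 : ℝ)..x, s * (C * exp (k * s ^ 2))
      = C / (2 * k) * exp (k * x ^ 2) - C / (2 * k) * exp (k * 0 ^ 2) :=
    intervalIntegral.integral_eq_sub_of_hasDerivAt (fun s _ => hprim s)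
      (Continuous.intervalIntegrable (by fun_prop) _ _)
  rw [abs_sub_comm, e1, ← norm_eq_abs]
  refine (intervalIntegral.norm_integral_le_of_norm_le (g := fun s => s * (C * exp (k * s ^ 2)))
    hx ?_ (Continuous.intervalIntegrable (by fun_prop) _ _)).trans ?_
  · refine Eventually.of_forall fun s hs => ?_
    rw [norm_eq_abs, abs_mul, abs_of_pos hs.1]
    refine mul_le_mul_of_nonneg_left (abs_radialAverage_le n fun y hy => (hC _).trans ?_) hs.1.le
    have : (y * s) ^ 2 ≤ s ^ 2 := by
      rw [mul_pow]
      have := pow_le_one₀ (n := 2) hy.1 hy.2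
      nlinarith [sq_nonneg s]
    gcongr
  · rw [e2]
    have : 0 ≤ C / (2 * k) * exp (k * 0 ^ 2) := by positivity
    linarith

/-- Global solvability of the radial initial value problem for a bounded Lipschitz nonlinearity. -/
theorem exists_radial_solution (n : ℕ) (γ : ℝ) {g : ℝ → ℝ} {L M : ℝ}
    (hL : ∀ x y, |g x - g y| ≤ L * |x - y|) (hM : ∀ x, |g x| ≤ M) :
    ∃ u u' u'' : ℝ → ℝ, (∀ x, HasDerivAt u (u' x) x) ∧ (∀ x, HasDerivAt u' (u'' x) x) ∧
      ContinuousOn u'' (Ici 0) ∧ u 0 = γ ∧ u' 0 = 0 ∧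
      ∀ x > 0, u'' x + n / x * u' x + g (u x) = 0 := by
  have hL0 : 0 ≤ L := by simpa using (abs_nonneg _).trans (hL 0 1)
  have hM0 : 0 ≤ M := (abs_nonneg _).trans (hM 0)
  have hgc : Continuous g := by
    refine (LipschitzWith.of_dist_le_mul (K := L.toNNReal) fun x y => ?_).continuous
    rw [Real.dist_eq, Real.dist_eq, Real.coe_toNNReal L hL0]
    exact hL x y
  set k := L + 1 with hk
  have hk0 : 0 < k := by linarith
  let H : BoundedContinuousFunction ℝ ℝ → ℝ → ℝ := fun v t => g (exp (k * t ^ 2) * v t)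
  have hH : ∀ v, Continuous (H v) := fun v => by
    have := v.continuous
    fun_prop
  have hP : ∀ v, Continuous (radialPicard n γ (H v)) := fun v =>
    continuous_iff_continuousAt.2 fun x => (hasDerivAt_radialPicard n γ (hH v) x).continuousAt
  let Φ : BoundedContinuousFunction ℝ ℝ → BoundedContinuousFunction ℝ ℝ := fun v =>
    BoundedContinuousFunction.ofNormedAddCommGroup
      (fun x => exp (-(k * x ^ 2)) * radialPicard n γ (H v) |x|)
      (by have := hP v; fun_prop) (|γ| + M / k) (by
        intro x
        have h1 := abs_radialPicard_le n γ (fun t => hM (exp (k * t ^ 2) * v t)) (abs_nonneg x)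
        rw [sq_abs] at h1
        rw [norm_eq_abs, abs_mul, abs_of_pos (exp_pos _), exp_neg, inv_mul_le_iff₀ (exp_pos _)]
        refine h1.trans ?_
        have h2 := add_one_le_exp (k * x ^ 2)
        have h3 : 0 ≤ k * x ^ 2 := by positivity
        have h4 : M * x ^ 2 = M / k * (k * x ^ 2) := by field_simp
        have h5 : 0 ≤ M / k := by positivity
        rw [h4]
        nlinarith [abs_nonneg γ])
  have hΦ : ContractingWith (1 / 2) Φ := by
    refine ⟨by norm_num, LipschitzWith.of_dist_le_mul fun v₁ v₂ => ?_⟩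
    rw [BoundedContinuousFunction.dist_le (by positivity)]
    intro x
    have h1 := abs_radialPicard_sub_le n γ (hH v₁) (hH v₂) (C := L * dist v₁ v₂) hk0 (by
      intro t
      refine (hL _ _).trans ?_
      rw [← mul_sub, abs_mul, abs_of_pos (exp_pos _)]
      have := BoundedContinuousFunction.dist_coe_le_dist (f := v₁) (g := v₂) t
      rw [Real.dist_eq] at this
      have h3 := mul_le_mul_of_nonneg_left this (mul_nonneg hL0 (exp_pos (k * t ^ 2)).le)
      linarith) (abs_nonneg x)
    simp only [Φ, BoundedContinuousFunction.coe_ofNormedAddCommGroup]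
    rw [sq_abs] at h1
    rw [Real.dist_eq, ← mul_sub, abs_mul, abs_of_pos (exp_pos _), exp_neg,
      inv_mul_le_iff₀ (exp_pos _)]
    refine h1.trans ?_
    rw [mul_comm]
    refine mul_le_mul_of_nonneg_left ?_ (exp_pos _).le
    rw [div_le_iff₀ (by positivity)]
    have := dist_nonneg (x := v₁) (y := v₂)
    push_cast
    nlinarith
  obtain ⟨v, hv⟩ : ∃ v, Φ v = v := ⟨_, hΦ.fixedPoint_isFixedPt⟩
  have hfix : ∀ x ≥ 0, H v x = g (radialPicard n γ (H v) x) := by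
    intro x hx
    have h1 : exp (-(k * x ^ 2)) * radialPicard n γ (H v) |x| = v x := DFunLike.congr_fun hv x
    simp only [H]
    rw [← h1, abs_of_nonneg hx, ← mul_assoc, ← exp_add, add_neg_cancel, exp_zero, one_mul]
  have hc := continuous_radialAverage n (hH v)
  refine ⟨radialPicard n γ (H v), fun x => -(x * radialAverage n (H v) x),
    fun x => -(H v x - n * radialAverage n (H v) x), hasDerivAt_radialPicard n γ (hH v),
    fun x => (hasDerivAt_mul_radialAverage n (hH v) x).neg, ?_, by simp [radialPicard], by simp, ?_⟩
  · have := hH v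
    fun_prop
  · intro x hx
    rw [← hfix x hx.le]
    field_simp
    ring

/-- Radially superharmonic functions are nonincreasing. -/
theorem radial_deriv_nonpos {n : ℕ} {u' u'' : ℝ → ℝ}
    (hu' : ∀ ρ ∈ Ici (0 : ℝ), HasDerivWithinAt u' (u'' ρ) (Ici 0) ρ) (h0 : u' 0 = 0)
    (hineq : ∀ ρ > 0, u'' ρ + n / ρ * u' ρ ≤ 0) : ∀ ρ ≥ 0, u' ρ ≤ 0 := by
  have hanti : AntitoneOn (fun ρ => ρ ^ n * u' ρ) (Ici 0) := by
    have hd : ∀ ρ > 0, HasDerivAt (fun ρ => ρ ^ n * u' ρ)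
        (n * ρ ^ (n - 1) * u' ρ + ρ ^ n * u'' ρ) ρ := fun ρ hρ =>
      (hasDerivAt_pow n ρ).mul ((hu' ρ (mem_Ici.2 hρ.le)).hasDerivAt (Ici_mem_nhds hρ))
    apply antitoneOn_of_deriv_nonpos (convex_Ici 0)
    · exact (continuous_pow n).continuousOn.mul fun ρ hρ => (hu' ρ hρ).continuousWithinAt
    · rw [interior_Ici]
      exact fun ρ hρ => (hd ρ hρ).differentiableAt.differentiableWithinAt
    · rw [interior_Ici]
      intro ρ hρ
      have hρ : 0 < ρ := hρ
      rw [(hd ρ hρ).deriv]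
      have e : n * ρ ^ (n - 1) * u' ρ + ρ ^ n * u'' ρ = ρ ^ n * (u'' ρ + n / ρ * u' ρ) := by
        rcases n with _ | n
        · simp
        · simp only [Nat.add_sub_cancel]
          field_simp
          ring
      rw [e]
      exact mul_nonpos_of_nonneg_of_nonpos (by positivity) (hineq ρ hρ)
  intro ρ hρ
  rcases hρ.eq_or_lt with rfl | hρ'
  · exact h0.le
  · have h : ρ ^ n * u' ρ ≤ 0 ^ n * u' 0 := hanti (mem_Ici.2 le_rfl) (mem_Ici.2 hρ) hρ
    rw [h0, mul_zero] at h
    exact nonpos_of_mul_nonpos_right h (by positivity)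

theorem antitoneOn_Ici_of_hasDerivWithinAt_nonpos {u u' : ℝ → ℝ}
    (hu : ∀ ρ ∈ Ici (0 : ℝ), HasDerivWithinAt u (u' ρ) (Ici 0) ρ) (hu' : ∀ ρ ≥ 0, u' ρ ≤ 0) :
    AntitoneOn u (Ici 0) := by
  have hd : ∀ ρ > 0, HasDerivAt u (u' ρ) ρ := fun ρ hρ =>
    (hu ρ (mem_Ici.2 hρ.le)).hasDerivAt (Ici_mem_nhds hρ)
  apply antitoneOn_of_deriv_nonpos (convex_Ici 0) fun ρ hρ => (hu ρ hρ).continuousWithinAt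
  · rw [interior_Ici]
    exact fun ρ hρ => (hd ρ hρ).differentiableAt.differentiableWithinAt
  · rw [interior_Ici]
    intro ρ hρ
    rw [(hd ρ hρ).deriv]
    exact hu' ρ (mem_Ioi.1 hρ).le

/-- Radial solutions of the initial value problem are unique when the difference of the
nonlinear terms is controlled by the difference of the solutions. -/
theorem radial_solution_unique {ν L : ℝ} (hν : 0 ≤ ν) (hL0 : 0 ≤ L)
    {u u' u'' f v v' v'' g : ℝ → ℝ}
    (hu : ∀ ρ ∈ Ici (0 : ℝ), HasDerivWithinAt u (u' ρ) (Ici 0) ρ)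
    (hu' : ∀ ρ ∈ Ici (0 : ℝ), HasDerivWithinAt u' (u'' ρ) (Ici 0) ρ)
    (hv : ∀ ρ ∈ Ici (0 : ℝ), HasDerivWithinAt v (v' ρ) (Ici 0) ρ)
    (hv' : ∀ ρ ∈ Ici (0 : ℝ), HasDerivWithinAt v' (v'' ρ) (Ici 0) ρ)
    (huv : u 0 = v 0) (huv' : u' 0 = v' 0)
    (hode : ∀ ρ > 0, u'' ρ + ν / ρ * u' ρ + f ρ = 0)
    (hode' : ∀ ρ > 0, v'' ρ + ν / ρ * v' ρ + g ρ = 0)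
    (hL : ∀ ρ > 0, |f ρ - g ρ| ≤ L * |u ρ - v ρ|) : EqOn u v (Ici 0) := by
  set E : ℝ → ℝ := fun ρ =>
    exp (-((L + 1) * ρ)) * ((u' ρ - v' ρ) ^ 2 + (u ρ - v ρ) ^ 2) with hE
  have hanti : AntitoneOn E (Ici 0) := by
    have hd : ∀ ρ ≥ 0, HasDerivWithinAt E
        (exp (-((L + 1) * ρ)) * (-((L + 1) * 1)) * ((u' ρ - v' ρ) ^ 2 + (u ρ - v ρ) ^ 2) +
          exp (-((L + 1) * ρ)) * (↑2 * (u' ρ - v' ρ) ^ (2 - 1) * (u'' ρ - v'' ρ) +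
            ↑2 * (u ρ - v ρ) ^ (2 - 1) * (u' ρ - v' ρ))) (Ici 0) ρ := by
      intro ρ hρ
      exact ((((hasDerivAt_id ρ).const_mul (L + 1)).neg.exp).hasDerivWithinAt).mul
        ((((hu' ρ hρ).sub (hv' ρ hρ)).pow 2).add (((hu ρ hρ).sub (hv ρ hρ)).pow 2))
    apply antitoneOn_of_deriv_nonpos (convex_Ici 0)
    · exact fun ρ hρ => (hd ρ hρ).continuousWithinAt
    · intro ρ hρ
      exact ((hd ρ (interior_subset hρ)).mono interior_subset).differentiableWithinAt
    · rw [interior_Ici]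
      intro ρ hρ
      have hρ : 0 < ρ := hρ
      rw [((hd ρ hρ.le).hasDerivAt (Ici_mem_nhds hρ)).deriv]
      have h1 : u'' ρ - v'' ρ = -(ν / ρ * (u' ρ - v' ρ)) - (f ρ - g ρ) := by
        linarith [hode ρ hρ, hode' ρ hρ]
      rw [h1]
      set e := u' ρ - v' ρ
      set d := u ρ - v ρ
      set q := f ρ - g ρ
      have h2 : |e * q| ≤ L * |e * d| := by
        rw [abs_mul, abs_mul]
        nlinarith [hL ρ hρ, abs_nonneg e]
      have h3 : 2 * |e * d| ≤ e ^ 2 + d ^ 2 := by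
        rw [abs_mul]
        nlinarith [sq_nonneg (|e| - |d|), sq_abs e, sq_abs d]
      have h4 : 0 ≤ ν / ρ * e ^ 2 := by positivity
      have h5 := neg_abs_le (e * q)
      have h6 := le_abs_self (e * d)
      have h7 : -(L + 1) * (e ^ 2 + d ^ 2) + (2 * e * (-(ν / ρ * e) - q) + 2 * d * e) ≤ 0 := by
        nlinarith
      have h8 := mul_nonpos_of_nonneg_of_nonpos (exp_pos (-((L + 1) * ρ))).le h7
      push_cast
      linarith
  intro ρ hρ
  have h := hanti (mem_Ici.2 le_rfl) hρ hρ
  simp only [hE, huv, huv', sub_self] at h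
  norm_num at h
  have h9 := nonpos_of_mul_nonpos_right h (exp_pos _)
  nlinarith [sq_nonneg (u' ρ - v' ρ), sq_nonneg (u ρ - v ρ)]

theorem abs_rpow_sub_rpow_le {p γ x y : ℝ} (hp : 1 ≤ p) (hx : x ∈ Icc 0 γ) (hy : y ∈ Icc 0 γ) :
    |x ^ p - y ^ p| ≤ p * γ ^ (p - 1) * |x - y| := by
  refine Convex.norm_image_sub_le_of_norm_hasDerivWithin_le (f := fun x : ℝ => x ^ p)
    (fun z _ => (hasDerivAt_rpow_const (Or.inr hp)).hasDerivWithinAt) (fun z hz => ?_)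
    (convex_Icc 0 γ) hy hx
  have := rpow_nonneg hz.1 (p - 1)
  rw [norm_eq_abs, abs_of_nonneg (by positivity)]
  have := rpow_le_rpow hz.1 hz.2 (by linarith : 0 ≤ p - 1)
  gcongr

/-- The Emden-Fowler transform `t ↦ exp (θ t) u(exp t)`. -/
def emdenFowler (θ : ℝ) (u : ℝ → ℝ) (t : ℝ) : ℝ := exp (θ * t) * u (exp t)

/-- The derivative of the Emden-Fowler transform. -/
def emdenFowlerDeriv (θ : ℝ) (u u' : ℝ → ℝ) (t : ℝ) : ℝ :=
  exp (θ * t) * (exp t * u' (exp t) + θ * u (exp t))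

/-- The energy of the autonomous Emden-Fowler equation. -/
def emdenFowlerEnergy (b p θ : ℝ) (u u' : ℝ → ℝ) (t : ℝ) : ℝ :=
  emdenFowlerDeriv θ u u' t ^ 2 / 2 - b * emdenFowler θ u t ^ 2 / 2
    + emdenFowler θ u t ^ (p + 1) / (p + 1)

theorem hasDerivAt_emdenFowler {θ t : ℝ} {u u' : ℝ → ℝ}
    (hu : HasDerivAt u (u' (exp t)) (exp t)) :
    HasDerivAt (emdenFowler θ u) (emdenFowlerDeriv θ u u' t) t := by
  refine ((((hasDerivAt_id t).const_mul θ).exp).mul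
    (hu.comp t (hasDerivAt_exp t))).congr_deriv ?_
  simp only [emdenFowlerDeriv, id, Function.comp]
  ring

theorem hasDerivAt_emdenFowlerDeriv {ν p θ t : ℝ} (hθ : (p - 1) * θ = 2)
    {u u' u'' : ℝ → ℝ} (hu : HasDerivAt u (u' (exp t)) (exp t))
    (hu' : HasDerivAt u' (u'' (exp t)) (exp t)) (hpos : 0 < u (exp t))
    (hode : u'' (exp t) + ν / exp t * u' (exp t) + u (exp t) ^ p = 0) :
    HasDerivAt (emdenFowlerDeriv θ u u')
      (-(ν - 1 - 2 * θ) * emdenFowlerDeriv θ u u' t + θ * (ν - 1 - θ) * emdenFowler θ u t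
        - emdenFowler θ u t ^ p) t := by
  have hexp := hasDerivAt_exp t
  refine ((((hasDerivAt_id t).const_mul θ).exp).mul ((hexp.mul (hu'.comp t hexp)).add
    ((hu.comp t hexp).const_mul θ))).congr_deriv ?_
  have e1 : emdenFowler θ u t ^ p = exp (θ * t) * exp t ^ 2 * u (exp t) ^ p := by
    rw [emdenFowler, mul_rpow (exp_pos _).le hpos.le, ← exp_mul, pow_two, ← exp_add, ← exp_add]
    congr 2
    linear_combination t * hθ
  have e2 : u'' (exp t) = -(ν / exp t * u' (exp t)) - u (exp t) ^ p := by linarith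
  rw [e1]
  simp only [emdenFowlerDeriv, emdenFowler, id, Function.comp, Pi.add_apply, Pi.mul_apply, e2]
  have := exp_pos t
  field_simp
  ring

section Energy

variable {ν p θ γ : ℝ} {u u' u'' : ℝ → ℝ}

theorem antitoneOn_emdenFowlerEnergy (hp : 1 < p) (hθ : (p - 1) * θ = 2) (ha : 2 * θ < ν - 1)
    (hu : ∀ ρ > 0, HasDerivAt u (u' ρ) ρ) (hu' : ∀ ρ > 0, HasDerivAt u' (u'' ρ) ρ)
    (hode : ∀ ρ > 0, 0 < u ρ → u'' ρ + ν / ρ * u' ρ + u ρ ^ p = 0) {t₀ : ℝ}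
    (hpos : ∀ t < t₀, 0 < u (exp t)) :
    AntitoneOn (emdenFowlerEnergy (θ * (ν - 1 - θ)) p θ u u') (Iic t₀) := by
  have hw : ∀ t, HasDerivAt (emdenFowler θ u) (emdenFowlerDeriv θ u u' t) t := fun t =>
    hasDerivAt_emdenFowler (hu _ (exp_pos t))
  have hcw : Continuous (emdenFowler θ u) :=
    continuous_iff_continuousAt.2 fun t => (hw t).continuousAt
  have hcw' : Continuous (emdenFowlerDeriv θ u u') := by
    have h1 : Continuous fun t => u (exp t) := continuous_iff_continuousAt.2 fun t =>
      (hu _ (exp_pos t)).continuousAt.comp continuous_exp.continuousAt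
    have h2 : Continuous fun t => u' (exp t) := continuous_iff_continuousAt.2 fun t =>
      (hu' _ (exp_pos t)).continuousAt.comp continuous_exp.continuousAt
    exact (by fun_prop : Continuous fun t => exp (θ * t)).mul
      ((continuous_exp.mul h2).add (h1.const_mul θ))
  have hd : ∀ t < t₀, HasDerivAt (emdenFowlerEnergy (θ * (ν - 1 - θ)) p θ u u')
      (-(ν - 1 - 2 * θ) * emdenFowlerDeriv θ u u' t ^ 2) t := by
    intro t ht
    have hw' := hasDerivAt_emdenFowlerDeriv hθ (hu _ (exp_pos t)) (hu' _ (exp_pos t)) (hpos t ht)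
      (hode _ (exp_pos t) (hpos t ht))
    refine ((((hw'.pow 2).div_const 2).sub ((((hw t).pow 2).const_mul _).div_const 2)).add
      (((hw t).rpow_const (p := p + 1) (Or.inr (by linarith))).div_const (p + 1))).congr_deriv ?_
    have : p + 1 ≠ 0 := by linarith
    field_simp
    simp only [add_sub_cancel_right]
    push_cast
    ring
  apply antitoneOn_of_deriv_nonpos (convex_Iic t₀)
  · have : Continuous fun t => emdenFowler θ u t ^ (p + 1) :=
      hcw.rpow_const fun _ => Or.inr (by linarith)
    unfold emdenFowlerEnergy
    fun_prop
  · rw [interior_Iic]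
    exact fun t ht => (hd t ht).differentiableAt.differentiableWithinAt
  · rw [interior_Iic]
    intro t ht
    rw [(hd t ht).deriv]
    nlinarith [sq_nonneg (emdenFowlerDeriv θ u u' t)]

theorem eventually_emdenFowlerEnergy_neg (hp : 1 < p) (hθ : (p - 1) * θ = 2)
    (ha : 2 * θ < ν - 1) (hγ : 0 < γ)
    (hu : ContinuousWithinAt u (Ici 0) 0) (hu' : ContinuousWithinAt u' (Ici 0) 0) (h0 : u 0 = γ) :
    ∀ᶠ t in atBot, emdenFowlerEnergy (θ * (ν - 1 - θ)) p θ u u' t < 0 := by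
  have hθ0 : 0 < θ := pos_of_mul_pos_right (hθ ▸ two_pos) (by linarith)
  set K : ℝ → ℝ := fun ρ => (ρ * u' ρ + θ * u ρ) ^ 2 / 2 - θ * (ν - 1 - θ) * u ρ ^ 2 / 2
    + ρ ^ 2 * u ρ ^ (p + 1) / (p + 1) with hK
  have hKc : ContinuousWithinAt K (Ici 0) 0 := by
    have h1 : ContinuousWithinAt (fun ρ => u ρ ^ (p + 1)) (Ici 0) 0 :=
      hu.rpow_const (Or.inr (by linarith))
    have h2 : ContinuousWithinAt (fun ρ : ℝ => ρ) (Ici 0) 0 := continuousWithinAt_id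
    exact (((((h2.mul hu').add (hu.const_mul θ)).pow 2).div_const 2).sub
      (((hu.pow 2).const_mul _).div_const 2)).add (((h2.pow 2).mul h1).div_const _)
  have hK0 : K 0 < 0 := by
    simp only [hK, h0]
    have : 0 < θ * (ν - 1 - 2 * θ) * γ ^ 2 := by
      have : 0 < ν - 1 - 2 * θ := by linarith
      positivity
    norm_num
    nlinarith
  have hev : ∀ᶠ ρ in 𝓝[>] (0 : ℝ), K ρ < 0 ∧ 0 < u ρ := by
    have hsub : 𝓝[>] (0 : ℝ) ≤ 𝓝[≥] 0 := nhdsWithin_mono _ Ioi_subset_Ici_self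
    have hK1 : ∀ᶠ ρ in 𝓝[≥] (0 : ℝ), K ρ < 0 := hKc.eventually (gt_mem_nhds hK0)
    refine (hK1.filter_mono hsub).and (Eventually.filter_mono hsub (hu.eventually ?_))
    rw [h0]
    exact lt_mem_nhds hγ
  filter_upwards [tendsto_exp_atBot_nhdsGT.eventually hev] with t ⟨ht, hut⟩
  have e : emdenFowlerEnergy (θ * (ν - 1 - θ)) p θ u u' t = exp (θ * t) ^ 2 * K (exp t) := by
    have e1 : emdenFowler θ u t ^ (p + 1)
        = exp (θ * t) ^ 2 * exp t ^ 2 * u (exp t) ^ (p + 1) := by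
      rw [emdenFowler, mul_rpow (exp_pos _).le hut.le, ← exp_mul, ← mul_pow, ← exp_add,
        ← exp_nat_mul]
      congr 2
      push_cast
      linear_combination t * hθ
    rw [emdenFowlerEnergy, e1]
    simp only [emdenFowler, emdenFowlerDeriv, hK]
    ring
  rw [e]
  exact mul_neg_of_pos_of_neg (by positivity) ht

theorem emdenFowlerEnergy_neg (hp : 1 < p) (hθ : (p - 1) * θ = 2) (ha : 2 * θ < ν - 1)
    (hγ : 0 < γ) (hu : ∀ ρ ∈ Ici (0 : ℝ), HasDerivWithinAt u (u' ρ) (Ici 0) ρ)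
    (hu' : ∀ ρ ∈ Ici (0 : ℝ), HasDerivWithinAt u' (u'' ρ) (Ici 0) ρ) (h0 : u 0 = γ)
    (hode : ∀ ρ > 0, 0 < u ρ → u'' ρ + ν / ρ * u' ρ + u ρ ^ p = 0) {t₀ : ℝ}
    (hpos : ∀ t < t₀, 0 < u (exp t)) :
    emdenFowlerEnergy (θ * (ν - 1 - θ)) p θ u u' t₀ < 0 := by
  obtain ⟨s, hs, hst⟩ := ((eventually_emdenFowlerEnergy_neg hp hθ ha hγ
    (hu 0 self_mem_Ici).continuousWithinAt (hu' 0 self_mem_Ici).continuousWithinAt h0).and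
    (eventually_le_atBot t₀)).exists
  exact (antitoneOn_emdenFowlerEnergy hp hθ ha
    (fun ρ hρ => (hu ρ (mem_Ici.2 hρ.le)).hasDerivAt (Ici_mem_nhds hρ))
    (fun ρ hρ => (hu' ρ (mem_Ici.2 hρ.le)).hasDerivAt (Ici_mem_nhds hρ)) hode hpos
    hst self_mem_Iic hst).trans_lt hs

/-- Supercritical regular solutions of the Lane-Emden equation have no zeros. -/
theorem laneEmden_pos (hp : 1 < p) (hθ : (p - 1) * θ = 2) (ha : 2 * θ < ν - 1)
    (hγ : 0 < γ) (hu : ∀ ρ ∈ Ici (0 : ℝ), HasDerivWithinAt u (u' ρ) (Ici 0) ρ)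
    (hu' : ∀ ρ ∈ Ici (0 : ℝ), HasDerivWithinAt u' (u'' ρ) (Ici 0) ρ) (h0 : u 0 = γ)
    (hode : ∀ ρ > 0, 0 < u ρ → u'' ρ + ν / ρ * u' ρ + u ρ ^ p = 0) : ∀ ρ ≥ 0, 0 < u ρ := by
  by_contra! h
  obtain ⟨ρ₁, hρ₁, hle⟩ := h
  have hc : ContinuousOn u (Ici 0) := fun ρ hρ => (hu ρ hρ).continuousWithinAt
  have hcpt : IsCompact (Icc 0 ρ₁ ∩ u ⁻¹' {0}) :=
    isCompact_Icc.of_isClosed_subset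
      ((hc.mono Icc_subset_Ici_self).preimage_isClosed_of_isClosed isClosed_Icc isClosed_singleton)
      inter_subset_left
  have hne : (Icc 0 ρ₁ ∩ u ⁻¹' {0}).Nonempty := by
    obtain ⟨ρ, hρ, hz⟩ := intermediate_value_Icc' hρ₁ (hc.mono Icc_subset_Ici_self)
      (⟨hle, h0 ▸ hγ.le⟩ : (0 : ℝ) ∈ Icc (u ρ₁) (u 0))
    exact ⟨ρ, hρ, hz⟩
  obtain ⟨ρ₀, ⟨hρ₀, hz⟩, hmin⟩ := hcpt.exists_isLeast hne
  have hz : u ρ₀ = 0 := hz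
  have hρ₀pos : 0 < ρ₀ := by
    refine hρ₀.1.lt_of_ne' ?_
    rintro rfl
    exact hγ.ne' (h0 ▸ hz)
  have hbefore : ∀ ρ ∈ Ico 0 ρ₀, 0 < u ρ := by
    intro ρ hρ
    by_contra! hneg
    obtain ⟨σ, hσ, hσz⟩ := intermediate_value_Icc' hρ.1 (hc.mono Icc_subset_Ici_self)
      (⟨hneg, h0 ▸ hγ.le⟩ : (0 : ℝ) ∈ Icc (u ρ) (u 0))
    exact absurd (hmin ⟨⟨hσ.1, hσ.2.trans (hρ.2.le.trans hρ₀.2)⟩, hσz⟩)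
      (hσ.2.trans_lt hρ.2).not_ge
  have hE := emdenFowlerEnergy_neg hp hθ ha hγ hu hu' h0 hode (t₀ := log ρ₀) fun t ht =>
    hbefore _ ⟨(exp_pos t).le, (lt_log_iff_exp_lt hρ₀pos).1 ht⟩
  rw [emdenFowlerEnergy, emdenFowler, exp_log hρ₀pos, hz, mul_zero,
    zero_rpow (by linarith)] at hE
  norm_num at hE
  nlinarith [sq_nonneg (emdenFowlerDeriv θ u u' (log ρ₀))]

/-- Positive regular solutions stay away from zero in Emden-Fowler variables. -/
theorem exists_pos_le_emdenFowler (hp : 1 < p) (hθ : (p - 1) * θ = 2) (ha : 2 * θ < ν - 1)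
    (hγ : 0 < γ) (hu : ∀ ρ ∈ Ici (0 : ℝ), HasDerivWithinAt u (u' ρ) (Ici 0) ρ)
    (hu' : ∀ ρ ∈ Ici (0 : ℝ), HasDerivWithinAt u' (u'' ρ) (Ici 0) ρ) (h0 : u 0 = γ)
    (hode : ∀ ρ > 0, 0 < u ρ → u'' ρ + ν / ρ * u' ρ + u ρ ^ p = 0) (T : ℝ) :
    ∃ κ > 0, ∀ t ≥ T, κ ≤ emdenFowler θ u t := by
  have hpos := laneEmden_pos hp hθ ha hγ hu hu' h0 hode
  have hposexp : ∀ t, 0 < u (exp t) := fun t => hpos _ (exp_pos t).le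
  have hθ0 : 0 < θ := pos_of_mul_pos_right (hθ ▸ two_pos) (by linarith)
  set b := θ * (ν - 1 - θ) with hb
  have hb0 : 0 < b := mul_pos hθ0 (by linarith)
  have hE := emdenFowlerEnergy_neg hp hθ ha hγ hu hu' h0 hode (t₀ := T) fun t _ => hposexp t
  set e := -emdenFowlerEnergy b p θ u u' T with he
  have he0 : 0 < e := by linarith
  refine ⟨√(2 * e / b), Real.sqrt_pos.2 (by positivity), fun t ht => ?_⟩
  have hanti : emdenFowlerEnergy b p θ u u' t ≤ emdenFowlerEnergy b p θ u u' T :=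
    antitoneOn_emdenFowlerEnergy hp hθ ha
      (fun ρ hρ => (hu ρ (mem_Ici.2 hρ.le)).hasDerivAt (Ici_mem_nhds hρ))
      (fun ρ hρ => (hu' ρ (mem_Ici.2 hρ.le)).hasDerivAt (Ici_mem_nhds hρ)) hode
      (t₀ := t) (fun t _ => hposexp t) ht self_mem_Iic ht
  have hw : 0 < emdenFowler θ u t := mul_pos (exp_pos _) (hposexp t)
  rw [Real.sqrt_le_left hw.le, div_le_iff₀ hb0]
  have h1 : emdenFowlerEnergy b p θ u u' t ≤ -e := by linarith
  rw [emdenFowlerEnergy] at h1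
  have h2 : 0 ≤ emdenFowler θ u t ^ (p + 1) / (p + 1) := by positivity
  nlinarith [sq_nonneg (emdenFowlerDeriv θ u u' t)]

end Energy

/-- Supercriticality in terms of `θ`. -/
theorem two_mul_thetaP_lt {N : ℕ} {p : ℝ} (hN : 3 ≤ N) (hp : 1 < p) (hpS : pSob N < p) :
    2 * thetaP p < (N : ℝ) - 1 - 1 := by
  have hN' : (3 : ℝ) ≤ N := by exact_mod_cast hN
  rw [pSob, div_lt_iff₀ (by linarith)] at hpS
  rw [thetaP, ← mul_div_assoc, div_lt_iff₀ (by linarith)]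
  nlinarith

theorem sub_one_mul_thetaP {p : ℝ} (hp : 1 < p) : (p - 1) * thetaP p = 2 :=
  mul_div_cancel₀ 2 (by linarith)

/-- Below the Joseph-Lundgren exponent the linearization at the singular solution oscillates. -/
theorem sq_lt_of_pJLcond {N : ℕ} {p : ℝ} (hN : 3 ≤ N) (hp : 1 < p) (hpS : pSob N < p)
    (hJL : pJLcond N p) :
    ((N : ℝ) - 1 - 1 - 2 * thetaP p) ^ 2 < 8 * ((N : ℝ) - 1 - 1 - thetaP p) := by
  have ha := two_mul_thetaP_lt hN hp hpS
  have hθ := sub_one_mul_thetaP hp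
  have hθ0 : 0 < thetaP p := div_pos two_pos (by linarith)
  have hN' : (3 : ℝ) ≤ N := by exact_mod_cast hN
  set r := √((N : ℝ) - 1) with hr
  have hr2 : r ^ 2 = N - 1 := Real.sq_sqrt (by linarith)
  have hr1 : 1 < r := Real.lt_sqrt_of_sq_lt (by linarith)
  have hlow : (N : ℝ) - 4 - 2 * r < 2 * thetaP p := by
    rcases le_or_gt ((N : ℝ) - 4 - 2 * r) 0 with h | h
    · linarith
    · have h11 : 11 ≤ N := by
        by_contra! h10
        have h10 : (N : ℝ) ≤ 10 := by exact_mod_cast Nat.lt_succ_iff.1 h10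
        nlinarith
      have h1 := hJL h11
      rw [← sub_lt_iff_lt_add', lt_div_iff₀ h] at h1
      nlinarith
  nlinarith

theorem IsBarSol.pos {N : ℕ} {p γ : ℝ} {u u' u'' : ℝ → ℝ} (h : IsBarSol N p γ u u' u'')
    (hN : 3 ≤ N) (hp : 1 < p) (hpS : pSob N < p) (hγ : 0 < γ) : ∀ ρ ≥ 0, 0 < u ρ := by
  obtain ⟨hu, hu', -, h0, -, hode⟩ := h
  exact laneEmden_pos hp (sub_one_mul_thetaP hp) (two_mul_thetaP_lt hN hp hpS) hγ hu hu' h0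
    fun ρ hρ _ => hode ρ hρ

theorem IsBarSol.mem_Icc {N : ℕ} {p γ : ℝ} {u u' u'' : ℝ → ℝ} (h : IsBarSol N p γ u u' u'')
    (hN : 3 ≤ N) (hp : 1 < p) (hpS : pSob N < p) (hγ : 0 < γ) : ∀ ρ ≥ 0, u ρ ∈ Icc 0 γ := by
  have hpos := h.pos hN hp hpS hγ
  obtain ⟨hu, hu', -, h0, h0', hode⟩ := h
  intro ρ hρ
  refine ⟨(hpos ρ hρ).le, ?_⟩
  have hanti := antitoneOn_Ici_of_hasDerivWithinAt_nonpos hu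
    (radial_deriv_nonpos (n := N - 1) hu' h0' fun ρ hρ => by
      have := rpow_nonneg (hpos ρ (le_of_lt hρ)).le p
      rw [Nat.cast_sub (by lia), Nat.cast_one]
      linarith [hode ρ hρ])
  rw [← h0]
  exact hanti self_mem_Ici hρ hρ

theorem IsBarSol.eqOn {N : ℕ} {p γ : ℝ} {u u' u'' v v' v'' : ℝ → ℝ}
    (hu : IsBarSol N p γ u u' u'') (hv : IsBarSol N p γ v v' v'')
    (hN : 3 ≤ N) (hp : 1 < p) (hpS : pSob N < p) (hγ : 0 < γ) : EqOn u v (Ici 0) := by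
  have hN' : (3 : ℝ) ≤ N := by exact_mod_cast hN
  have hmu := hu.mem_Icc hN hp hpS hγ
  have hmv := hv.mem_Icc hN hp hpS hγ
  obtain ⟨hu, hu', -, hu0, hu0', hode⟩ := hu
  obtain ⟨hv, hv', -, hv0, hv0', hode'⟩ := hv
  exact radial_solution_unique (by linarith : (0 : ℝ) ≤ N - 1)
    (by positivity : 0 ≤ p * γ ^ (p - 1)) hu hu' hv hv' (hu0.trans hv0.symm)
    (hu0'.trans hv0'.symm) hode hode' fun ρ hρ =>
      abs_rpow_sub_rpow_le hp.le (hmu ρ (le_of_lt hρ)) (hmv ρ (le_of_lt hρ))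

theorem exists_isBarSol {N : ℕ} {p γ : ℝ} (hN : 3 ≤ N) (hp : 1 < p) (hpS : pSob N < p)
    (hγ : 0 < γ) : ∃ u u' u'' : ℝ → ℝ, IsBarSol N p γ u u' u'' := by
  set g : ℝ → ℝ := fun x => max 0 (min γ x) ^ p with hg
  have hmem : ∀ x, max 0 (min γ x) ∈ Icc 0 γ := fun x =>
    ⟨le_max_left _ _, max_le hγ.le (min_le_left _ _)⟩
  have hg0 : ∀ x, 0 ≤ g x := fun x => rpow_nonneg (hmem x).1 p
  obtain ⟨u, u', u'', hu, hu', hc, h0, h0', hode⟩ :=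
    exists_radial_solution (N - 1) γ (g := g) (L := p * γ ^ (p - 1)) (M := γ ^ p)
      (fun x y => (abs_rpow_sub_rpow_le hp.le (hmem x) (hmem y)).trans <| by
        have h1 := abs_max_sub_max_le_max 0 (min γ x) 0 (min γ y)
        have h2 := abs_min_sub_min_le_max γ x γ y
        simp only [sub_self, abs_zero, abs_nonneg, max_eq_right] at h1 h2
        have := h1.trans h2
        gcongr)
      (fun x => by
        rw [abs_of_nonneg (hg0 x)]
        exact rpow_le_rpow (hmem x).1 (hmem x).2 (by linarith))
  have huw : ∀ ρ ∈ Ici (0 : ℝ), HasDerivWithinAt u (u' ρ) (Ici 0) ρ := fun ρ _ =>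
    (hu ρ).hasDerivWithinAt
  have hu'w : ∀ ρ ∈ Ici (0 : ℝ), HasDerivWithinAt u' (u'' ρ) (Ici 0) ρ := fun ρ _ =>
    (hu' ρ).hasDerivWithinAt
  have hle : ∀ ρ ≥ 0, u ρ ≤ γ := by
    intro ρ hρ
    have := antitoneOn_Ici_of_hasDerivWithinAt_nonpos huw
      (radial_deriv_nonpos hu'w h0' fun ρ hρ => by linarith [hode ρ hρ, hg0 (u ρ)])
      self_mem_Ici hρ hρ
    rwa [h0] at this
  have hode' : ∀ ρ > 0, 0 < u ρ → u'' ρ + ((N : ℝ) - 1) / ρ * u' ρ + u ρ ^ p = 0 := by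
    intro ρ hρ hpos
    have h1 := hode ρ hρ
    have h2 : g (u ρ) = u ρ ^ p := by
      simp only [hg, min_eq_right (hle ρ hρ.le), max_eq_right hpos.le]
    rwa [Nat.cast_sub (by lia), Nat.cast_one, h2] at h1
  have hpos := laneEmden_pos hp (sub_one_mul_thetaP hp) (two_mul_thetaP_lt hN hp hpS) hγ huw hu'w
    h0 hode'
  exact ⟨u, u', u'', huw, hu'w, hc, h0, h0', fun ρ hρ => hode' ρ hρ (hpos ρ (le_of_lt hρ))⟩

theorem IsBarSol.rescale {N : ℕ} {p γ : ℝ} {v v' v'' : ℝ → ℝ} (h : IsBarSol N p 1 v v' v'')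
    (hN : 3 ≤ N) (hp : 1 < p) (hpS : pSob N < p) (hγ : 0 < γ) :
    IsBarSol N p γ (fun ρ => γ * v (γ ^ ((p - 1) / 2) * ρ))
      (fun ρ => γ * γ ^ ((p - 1) / 2) * v' (γ ^ ((p - 1) / 2) * ρ))
      (fun ρ => γ ^ p * v'' (γ ^ ((p - 1) / 2) * ρ)) := by
  have hpos := h.pos hN hp hpS one_pos
  obtain ⟨hv, hv', hc, h0, h0', hode⟩ := h
  set σ := γ ^ ((p - 1) / 2) with hσ
  have hσ0 : 0 < σ := by positivity
  have hσ2 : γ ^ p = γ * σ * σ := by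
    rw [mul_assoc, hσ, ← rpow_add hγ, mul_comm, ← rpow_add_one hγ.ne']
    ring_nf
  have hmaps : MapsTo (fun ρ => σ * ρ) (Ici 0) (Ici 0) := fun ρ hρ =>
    mul_nonneg hσ0.le hρ
  have hlin : ∀ ρ, HasDerivWithinAt (fun ρ => σ * ρ) σ (Ici 0) ρ := fun ρ => by
    simpa using (hasDerivWithinAt_id ρ (Ici (0 : ℝ))).const_mul σ
  refine ⟨fun ρ hρ => ?_, fun ρ hρ => ?_, ?_, by simp [h0], by simp [h0'], fun ρ hρ => ?_⟩
  · refine (((hv _ (hmaps hρ)).comp ρ (hlin ρ) hmaps).const_mul γ).congr_deriv ?_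
    ring
  · refine (((hv' _ (hmaps hρ)).comp ρ (hlin ρ) hmaps).const_mul (γ * σ)).congr_deriv ?_
    rw [hσ2]
    ring
  · exact (hc.comp (by fun_prop) hmaps).const_mul (γ ^ p)
  · have h1 := hode (σ * ρ) (mul_pos hσ0 hρ)
    rw [mul_rpow hγ.le (hpos _ (hmaps (le_of_lt hρ))).le]
    have h2 : γ * σ * σ * (v'' (σ * ρ) + ((N : ℝ) - 1) / (σ * ρ) * v' (σ * ρ) + v (σ * ρ) ^ p)
        = 0 := by
      rw [h1, mul_zero]
    rw [hσ2, ← h2]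
    have hρ : 0 < ρ := hρ
    field_simp

theorem IsBarSol.infinite_intersections {N : ℕ} {p γ : ℝ} {u u' u'' : ℝ → ℝ}
    (h : IsBarSol N p γ u u' u'') (hN : 3 ≤ N) (hp : 1 < p) (hpS : pSob N < p)
    (hJL : pJLcond N p) (hγ : 0 < γ) :
    {ρ : ℝ | 0 < ρ ∧ u ρ = Aconst N p * ρ ^ (-(thetaP p))}.Infinite := by
  have ha := two_mul_thetaP_lt hN hp hpS
  have hθ := sub_one_mul_thetaP hp
  have hθ0 : 0 < thetaP p := div_pos two_pos (by linarith)
  have hosc := sq_lt_of_pJLcond hN hp hpS hJL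
  have hpos := h.pos hN hp hpS hγ
  obtain ⟨hu, hu', -, h0, -, hode⟩ := h
  have hb : 0 < thetaP p * ((N : ℝ) - 1 - 1 - thetaP p) := mul_pos hθ0 (by linarith)
  have hA : Aconst N p = (thetaP p * ((N : ℝ) - 1 - 1 - thetaP p)) ^ (1 / (p - 1)) := by
    rw [Aconst]
    ring_nf
  have hA0 : 0 < Aconst N p := by rw [hA]; positivity
  have hAp : Aconst N p ^ (p - 1) = thetaP p * ((N : ℝ) - 1 - 1 - thetaP p) := by
    rw [hA, ← rpow_mul hb.le, one_div_mul_cancel (by linarith), rpow_one]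
  have hreturn : ∀ T, ∃ t ≥ T, emdenFowler (thetaP p) u t = Aconst N p := by
    intro T
    obtain ⟨κ, hκ, hκw⟩ := exists_pos_le_emdenFowler hp hθ ha hγ hu hu' h0
      (fun ρ hρ _ => hode ρ hρ) T
    have hu1 : ∀ t, HasDerivAt u (u' (exp t)) (exp t) := fun t =>
      (hu _ (mem_Ici.2 (exp_pos t).le)).hasDerivAt (Ici_mem_nhds (exp_pos t))
    refine exists_ge_eq_equilibrium (a := (N : ℝ) - 1 - 1 - 2 * thetaP p) (by linarith) hp hA0 hκ
      ?_ (fun t => hasDerivAt_emdenFowler (hu1 t)) (fun t => ?_) hκw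
    · rw [hAp, ← mul_assoc (p - 1), hθ]
      linarith
    · rw [hAp]
      exact hasDerivAt_emdenFowlerDeriv hθ (hu1 t)
        ((hu' _ (mem_Ici.2 (exp_pos t).le)).hasDerivAt (Ici_mem_nhds (exp_pos t)))
        (hpos _ (exp_pos t).le) (hode _ (exp_pos t))
  refine infinite_of_not_bddAbove fun ⟨B, hB⟩ => ?_
  obtain ⟨t, ht, htA⟩ := hreturn (|B| + 1)
  have hmem : exp t ∈ {ρ : ℝ | 0 < ρ ∧ u ρ = Aconst N p * ρ ^ (-(thetaP p))} := by
    refine ⟨exp_pos t, ?_⟩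
    rw [← htA, emdenFowler, ← exp_mul, mul_right_comm, ← exp_add]
    ring_nf
    simp
  linarith [hB hmem, le_abs_self B, add_one_le_exp t]

/-- Proposition 2.1: for `p > p_S` the Lane-Emden IVP has a unique
positive global solution obeying the scaling relation, and for `p_S < p < p_JL`
every regular solution intersects the singular solution `A ρ^{-θ}` infinitely often. -/
theorem lane_emden_regular_solutions (N : ℕ) (hN : 3 ≤ N) (p : ℝ) (hp : 1 < p)
    (hpS : pSob N < p) :
    (∀ γ > (0:ℝ), ∃ u u' u'' : ℝ → ℝ, IsBarSol N p γ u u' u'') ∧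
    (∀ γ > (0:ℝ), ∀ u₁ u₁' u₁'' u₂ u₂' u₂'' : ℝ → ℝ,
      IsBarSol N p γ u₁ u₁' u₁'' → IsBarSol N p γ u₂ u₂' u₂'' →
      EqOn u₁ u₂ (Ici 0)) ∧
    (∀ γ > (0:ℝ), ∀ u u' u'' : ℝ → ℝ, IsBarSol N p γ u u' u'' →
      ∀ ρ ≥ (0:ℝ), 0 < u ρ) ∧
    (∀ γ > (0:ℝ), ∀ u u' u'' v v' v'' : ℝ → ℝ,
      IsBarSol N p γ u u' u'' → IsBarSol N p 1 v v' v'' →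
      ∀ ρ ≥ (0:ℝ), u ρ = γ * v (γ ^ ((p - 1) / 2) * ρ)) ∧
    (pJLcond N p → ∀ γ > (0:ℝ), ∀ u u' u'' : ℝ → ℝ, IsBarSol N p γ u u' u'' →
      {ρ : ℝ | 0 < ρ ∧ u ρ = Aconst N p * ρ ^ (-(thetaP p))}.Infinite) := by
  exact ⟨fun γ hγ => exists_isBarSol hN hp hpS hγ,
    fun γ hγ u₁ u₁' u₁'' u₂ u₂' u₂'' h₁ h₂ => h₁.eqOn h₂ hN hp hpS hγ,
    fun γ hγ u u' u'' h => h.pos hN hp hpS hγ,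
    fun γ hγ u u' u'' v v' v'' hu hv ρ hρ =>
      hu.eqOn (hv.rescale hN hp hpS hγ) hN hp hpS hγ hρ,
    fun hJL γ hγ u u' u'' h => h.infinite_intersections hN hp hpS hJL hγ⟩
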